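/- Let N ≥ 1 be an integer, d > 0, κ = 2 + N d, C₁ > 0, B > 0 and T > 0. Let φ : (0, T) → [0, ∞) be such that τ ↦ τ^{−Nd/κ} φ(τ)^{1+d} is integrable on (0, t) for every t ∈ (0, T), and assume φ(t) ≤ C₁ ∫₀ᵗ τ^{−Nd/κ} φ(τ)^{1+d} dτ + B for all t ∈ (0, T). Then for every t ∈ (0, T) with B^{−d} − (dκ/2) C₁ t^{2/κ} > 0, one has φ(t) ≤ (B^{−d} − (dκ/2) C₁ t^{2/κ})^{−1/d}. -/

import Mathlib

open MeasureTheory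

/-- Tangent line inequality for the convex function `x ↦ x ^ (-d)` on the positive reals. -/
theorem rpow_neg_sub_rpow_neg_le {d x y : ℝ} (hd : 0 < d) (hx : 0 < x) (hy : 0 < y) :
    x ^ (-d) - y ^ (-d) ≤ d * ((y - x) / x ^ (1 + d)) := by
  have hlog : Real.log (y / x) ≤ y / x - 1 := Real.log_le_sub_one_of_pos (by positivity)
  have hbern : 1 - d * (y / x - 1) ≤ (y / x) ^ (-d) := by
    rw [Real.rpow_def_of_pos (by positivity)]
    nlinarith [Real.add_one_le_exp (Real.log (y / x) * -d)]
  have hxd : 0 < x ^ d := by positivity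
  have hyd : 0 < y ^ d := by positivity
  rw [Real.div_rpow hy.le hx.le, le_div_iff₀ (by positivity)] at hbern
  rw [Real.rpow_add hx, Real.rpow_one]
  have hxn : x ^ (-d) = (x ^ d)⁻¹ := Real.rpow_neg hx.le d
  rw [hxn] at hbern ⊢
  have : d * ((y - x) / (x * x ^ d)) = d * (y / x - 1) * (x ^ d)⁻¹ := by
    field_simp
  rw [this]
  linarith

/-- A continuous positive `G` with `G z - G x ≤ G z ^ (1 + d) * (W z - W x)` for `x ≤ z` satisfies
the integrated form of `(-G ^ (-d))' ≤ d W'`. -/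
theorem rpow_neg_sub_rpow_neg_le_of_sub_le {G W w : ℝ → ℝ} {a b d : ℝ} (hd : 0 < d) (hab : a ≤ b)
    (hG : ContinuousOn G (Set.Icc a b)) (hpos : ∀ x ∈ Set.Icc a b, 0 < G x)
    (hW : ∀ x ∈ Set.Icc a b, HasDerivAt W (w x) x)
    (h : ∀ x ∈ Set.Icc a b, ∀ z ∈ Set.Icc a b, x ≤ z → G z - G x ≤ G z ^ (1 + d) * (W z - W x)) :
    G a ^ (-d) - G b ^ (-d) ≤ d * (W b - W a) := by
  have key := image_le_of_liminf_slope_right_le_deriv_boundary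
    (f := fun x => -G x ^ (-d)) (B := fun x => d * (W x - W a) - G a ^ (-d))
    (B' := fun x => d * w x) (a := a) (b := b)
    (hG.rpow_const fun x hx => Or.inl (hpos x hx).ne').neg
    (by simp)
    (fun x hx => ((((hW x hx).continuousAt.sub continuousAt_const).const_mul d).sub
      continuousAt_const).continuousWithinAt)
    (fun x hx => ((((hW x (Set.Ico_subset_Icc_self hx)).sub_const _).const_mul d).sub_const
      _).hasDerivWithinAt)
    ?_ (Set.right_mem_Icc.2 hab)
  · linarith
  intro x hx r hr
  have hxI := Set.Ico_subset_Icc_self hx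
  have hGx := hpos x hxI
  have hGlim : Filter.Tendsto G (nhdsWithin x (Set.Ioi x)) (nhds (G x)) :=
    (hG x hxI).mono_of_mem_nhdsWithin (Icc_mem_nhdsGT_of_mem hx)
  have hWlim : Filter.Tendsto (slope W x) (nhdsWithin x (Set.Ioi x)) (nhds (w x)) :=
    (hasDerivWithinAt_iff_tendsto_slope' (by simp)).1 (hW x hxI).hasDerivWithinAt
  have hlim : Filter.Tendsto (fun z => d * (G z ^ (1 + d) / G x ^ (1 + d) * slope W x z))
      (nhdsWithin x (Set.Ioi x)) (nhds (d * w x)) := by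
    have := (((hGlim.rpow_const (p := 1 + d) (Or.inl hGx.ne')).div_const
      (G x ^ (1 + d))).mul hWlim).const_mul d
    rwa [div_self (by positivity), one_mul] at this
  refine Filter.Eventually.frequently ?_
  filter_upwards [hlim.eventually_lt_const hr, Icc_mem_nhdsGT_of_mem hx, self_mem_nhdsWithin]
    with z hz hzI hxz
  refine lt_of_le_of_lt ?_ hz
  have hzx : 0 < z - x := sub_pos.2 hxz
  have hle : G x ^ (-d) - G z ^ (-d) ≤ d * (G z ^ (1 + d) * (W z - W x) / G x ^ (1 + d)) :=
    (rpow_neg_sub_rpow_neg_le hd hGx (hpos z hzI)).trans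
      (by gcongr; exact h x hxI z hzI (le_of_lt hxz))
  rw [slope_def_field, slope_def_field, div_le_iff₀ hzx]
  calc -G z ^ (-d) - -G x ^ (-d) = G x ^ (-d) - G z ^ (-d) := by ring
    _ ≤ _ := hle
    _ = _ := by field_simp

/-- Integrated nonlinear Gronwall inequality with the weight `τ ^ p`, where `p > -1`. -/
theorem rpow_neg_sub_le_rpow_neg_of_le_integral {p d C B b : ℝ} (hp : -1 < p) (hd : 0 < d)
    (hC : 0 < C) (hB : 0 < B) (hb : 0 < b) {φ : ℝ → ℝ} (hφ0 : ∀ t ∈ Set.Ioc 0 b, 0 ≤ φ t)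
    (hint : IntegrableOn (fun τ => τ ^ p * φ τ ^ (1 + d)) (Set.Ioc 0 b))
    (hineq : ∀ t ∈ Set.Ioc 0 b, φ t ≤ C * (∫ τ in Set.Ioc 0 t, τ ^ p * φ τ ^ (1 + d)) + B) :
    B ^ (-d) - d * (C * (b ^ (p + 1) / (p + 1))) ≤
      (C * (∫ τ in Set.Ioc 0 b, τ ^ p * φ τ ^ (1 + d)) + B) ^ (-d) := by
  have hp1 : 0 < p + 1 := by linarith
  set f : ℝ → ℝ := fun τ => τ ^ p * φ τ ^ (1 + d)
  set G : ℝ → ℝ := fun t => C * (∫ τ in Set.Ioc 0 t, f τ) + B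
  set W : ℝ → ℝ := fun t => C * (t ^ (p + 1) / (p + 1))
  have hf0 : ∀ τ ∈ Set.Ioc 0 b, 0 ≤ f τ := fun τ hτ =>
    mul_nonneg (Real.rpow_nonneg hτ.1.le _) (Real.rpow_nonneg (hφ0 τ hτ) _)
  have hGcont : ContinuousOn G (Set.Icc 0 b) :=
    ((intervalIntegral.continuousOn_primitive
      ((integrableOn_Icc_iff_integrableOn_Ioc).2 hint)).const_mul C).add_const B
  have hGsub : ∀ x z, 0 ≤ x → x ≤ z → z ≤ b → G z - G x = C * ∫ τ in x..z, f τ := by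
    intro x z hx hxz hz
    have hI : ∀ u v, 0 ≤ u → u ≤ v → v ≤ b → IntervalIntegrable f volume u v :=
      fun u v hu huv hv => (intervalIntegrable_iff_integrableOn_Ioc_of_le huv).2
        (hint.mono_set (Set.Ioc_subset_Ioc hu hv))
    have hadd := intervalIntegral.integral_add_adjacent_intervals
      (hI 0 x le_rfl hx (hxz.trans hz)) (hI x z hx hxz hz)
    rw [intervalIntegral.integral_of_le hx, intervalIntegral.integral_of_le (hx.trans hxz)] at hadd
    simp only [G]
    rw [← hadd]
    ring
  have hGmono : ∀ x z, 0 ≤ x → x ≤ z → z ≤ b → G x ≤ G z := by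
    intro x z hx hxz hz
    rw [← sub_nonneg, hGsub x z hx hxz hz, intervalIntegral.integral_of_le hxz]
    exact mul_nonneg hC.le (setIntegral_nonneg measurableSet_Ioc fun τ hτ =>
      hf0 τ (Set.Ioc_subset_Ioc hx hz hτ))
  have hG0 : G 0 = B := by simp [G]
  have hGpos : ∀ x ∈ Set.Icc 0 b, 0 < G x := fun x hx =>
    hB.trans_le (hG0 ▸ hGmono 0 x le_rfl hx.1 hx.2)
  have hGinc : ∀ x z, 0 ≤ x → x ≤ z → z ≤ b →
      G z - G x ≤ G z ^ (1 + d) * (W z - W x) := by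
    intro x z hx hxz hz
    have hle : ∫ τ in x..z, f τ ≤ ∫ τ in x..z, τ ^ p * G z ^ (1 + d) := by
      rw [intervalIntegral.integral_of_le hxz, intervalIntegral.integral_of_le hxz]
      refine setIntegral_mono_on (hint.mono_set (Set.Ioc_subset_Ioc hx hz))
        (((intervalIntegral.intervalIntegrable_rpow' hp).mul_const _).1) measurableSet_Ioc ?_
      intro τ hτ
      have hτb : τ ∈ Set.Ioc 0 b := Set.Ioc_subset_Ioc hx hz hτ
      have hφG : φ τ ≤ G z := (hineq τ hτb).trans (hGmono τ z hτb.1.le hτ.2 hz)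
      exact mul_le_mul_of_nonneg_left
        (Real.rpow_le_rpow (hφ0 τ hτb) hφG (by linarith)) (Real.rpow_nonneg hτb.1.le _)
    rw [intervalIntegral.integral_mul_const, integral_rpow (Or.inl hp)] at hle
    calc G z - G x = C * ∫ τ in x..z, f τ := hGsub x z hx hxz hz
      _ ≤ C * ((z ^ (p + 1) - x ^ (p + 1)) / (p + 1) * G z ^ (1 + d)) := by gcongr
      _ = _ := by simp only [W]; ring
  have hstep : ∀ a ∈ Set.Ioc 0 b, G a ^ (-d) - G b ^ (-d) ≤ d * (W b - W a) := by
    intro a ha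
    refine rpow_neg_sub_rpow_neg_le_of_sub_le (w := fun x => C * x ^ p) hd ha.2
      (hGcont.mono (Set.Icc_subset_Icc_left ha.1.le))
      (fun x hx => hGpos x ⟨ha.1.le.trans hx.1, hx.2⟩) ?_
      (fun x hx z hz hxz => hGinc x z (ha.1.le.trans hx.1) hxz hz.2)
    intro x hx
    have := ((Real.hasDerivAt_rpow_const (p := p + 1)
      (Or.inl (ha.1.trans_le hx.1).ne')).div_const (p + 1)).const_mul C
    rwa [add_sub_cancel_right, mul_div_cancel_left₀ _ hp1.ne'] at this
  have hW0 : W 0 = 0 := by simp [W, Real.zero_rpow hp1.ne']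
  have hWcont : Continuous W :=
    ((Real.continuous_rpow_const hp1.le).div_const _).const_mul C
  have hmem : Set.Icc 0 b ∈ nhdsWithin (0 : ℝ) (Set.Ioi 0) :=
    Icc_mem_nhdsGT_of_mem ⟨le_rfl, hb⟩
  have hGlim : Filter.Tendsto G (nhdsWithin 0 (Set.Ioi 0)) (nhds (G 0)) :=
    (hGcont 0 ⟨le_rfl, hb.le⟩).mono_of_mem_nhdsWithin hmem
  have hWlim : Filter.Tendsto W (nhdsWithin 0 (Set.Ioi 0)) (nhds (W 0)) :=
    hWcont.continuousAt.mono_left nhdsWithin_le_nhds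
  rw [hG0] at hGlim
  have hlim := le_of_tendsto_of_tendsto
    ((hGlim.rpow_const (p := -d) (Or.inl hB.ne')).sub_const (G b ^ (-d)))
    ((hWlim.const_sub (W b)).const_mul d)
    (by filter_upwards [Ioc_mem_nhdsGT hb] with a ha using hstep a ha)
  rw [hW0, sub_zero] at hlim
  change B ^ (-d) - d * W b ≤ G b ^ (-d)
  linarith

/-- Nonlinear Gronwall-type majorization (proof of Lemma 4.6): if `κ = 2 + Nd` and
`φ ≥ 0` satisfies `φ(t) ≤ C₁ ∫₀ᵗ τ^{−Nd/κ} φ(τ)^{1+d} dτ + B` on `(0,T)`, then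
`φ(t) ≤ (B^{−d} − (dκ/2) C₁ t^{2/κ})^{−1/d}` whenever the base is positive. -/
theorem gronwall_majorization_phi
    (N : ℕ) (hN : 1 ≤ N) (d : ℝ) (hd : 0 < d)
    (κ : ℝ) (hκ : κ = 2 + (N : ℝ) * d)
    (C₁ B T : ℝ) (hC₁ : 0 < C₁) (hB : 0 < B) (hT : 0 < T)
    (φ : ℝ → ℝ)
    (hφ0 : ∀ t ∈ Set.Ioo (0:ℝ) T, 0 ≤ φ t)
    (hint : ∀ t ∈ Set.Ioo (0:ℝ) T,
      IntegrableOn (fun τ => τ ^ (-((N : ℝ) * d) / κ) * φ τ ^ (1 + d)) (Set.Ioc 0 t))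
    (hineq : ∀ t ∈ Set.Ioo (0:ℝ) T,
      φ t ≤ C₁ * (∫ τ in Set.Ioc (0:ℝ) t, τ ^ (-((N : ℝ) * d) / κ) * φ τ ^ (1 + d)) + B) :
    ∀ t ∈ Set.Ioo (0:ℝ) T, 0 < B ^ (-d) - d * κ / 2 * C₁ * t ^ (2 / κ) →
      φ t ≤ (B ^ (-d) - d * κ / 2 * C₁ * t ^ (2 / κ)) ^ (-1 / d) := by
  intro t ht hpos
  have hNd : 0 < (N : ℝ) * d := by positivity
  have hκ0 : 0 < κ := by linarith
  have hexp : -((N : ℝ) * d) / κ + 1 = 2 / κ := by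
    field_simp
    linarith
  have hp : -1 < -((N : ℝ) * d) / κ := by
    have : 0 < 2 / κ := by positivity
    linarith
  have hsub : Set.Ioc 0 t ⊆ Set.Ioo 0 T := fun s hs => ⟨hs.1, hs.2.trans_lt ht.2⟩
  have key := rpow_neg_sub_le_rpow_neg_of_le_integral hp hd hC₁ hB ht.1
    (fun s hs => hφ0 s (hsub hs)) (hint t ht) (fun s hs => hineq s (hsub hs))
  have hcoef : d * (C₁ * (t ^ (2 / κ) / (2 / κ))) = d * κ / 2 * C₁ * t ^ (2 / κ) := by
    field_simp
  rw [hexp, hcoef] at key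
  refine (hineq t ht).trans ?_
  set g := C₁ * (∫ τ in Set.Ioc (0:ℝ) t, τ ^ (-((N : ℝ) * d) / κ) * φ τ ^ (1 + d)) + B
  have hg : 0 ≤ g := (hφ0 t ht).trans (hineq t ht)
  calc g = (g ^ (-d)) ^ (-1 / d) := by
        rw [← Real.rpow_mul hg, show -d * (-1 / d) = 1 by field_simp, Real.rpow_one]
    _ ≤ _ := Real.rpow_le_rpow_of_nonpos hpos key
        (div_nonpos_of_nonpos_of_nonneg (by norm_num) hd.le)
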